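/- Let 0 ≤ m ≤ n and j ≥ 1 be integers. Then the trace of the operator (P_n^m M P_n^m)^j restricted to Π_n^m equals Σ_{k=−n}^n Σ_{i=1}^{N_k} x_{|k|,i}^j, where for −m ≤ k ≤ m the numbers x_{|k|,i}, 1 ≤ i ≤ N_k = n−m+1, are the roots of the associated ultraspherical polynomial p_{n−m+1}^{(|k|)}(·, m−|k|), and for m+1 ≤ |k| ≤ n the numbers x_{|k|,i}, 1 ≤ i ≤ N_k = n−|k|+1, are the roots of the ultraspherical polynomial p_{n−|k|+1}^{(|k|)}. -/

import Mathlib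

open MeasureTheory Finset

noncomputable section

namespace SFT

/-- The recurrence coefficients `b_l^{(α)}` of the orthonormal ultraspherical polynomials. -/
def b (α : ℝ) : ℕ → ℝ
  | 0 => Real.sqrt (Real.sqrt Real.pi * Real.Gamma (α + 1) / (2 * Real.Gamma (α + 3 / 2)))
  | l + 1 => Real.sqrt ((((l : ℝ) + 1) * (((l : ℝ) + 1) + 2 * α)) /
      ((2 * ((l : ℝ) + 1) + 2 * α + 1) * (2 * ((l : ℝ) + 1) + 2 * α - 1)))

/-- The associated ultraspherical polynomials: `pA α m l x = p_l^{(α)}(x, m)`.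
For `m = 0` these are the orthonormal ultraspherical polynomials `p_l^{(α)}(x)`. -/
def pA (α : ℝ) (m : ℕ) : ℕ → ℝ → ℝ
  | 0, _ => 1 / b α m
  | 1, x => x * (1 / b α m) / b α (m + 1)
  | l + 2, x => (x * pA α m (l + 1) x - b α (m + l + 1) * pA α m l x) / b α (m + l + 2)

/-- The orthonormal ultraspherical polynomials `p_l^{(α)}(x)`. -/
def p (α : ℝ) (l : ℕ) (x : ℝ) : ℝ := pA α 0 l x

/-- Ultraspherical polynomials with integer index; in particular `p_{-1}^{(α)} = 0`. -/
def pZ (α : ℝ) (l : ℤ) (x : ℝ) : ℝ := if 0 ≤ l then p α l.toNat x else 0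

/-- `JE α M i j` is the `(i,j)` entry (`0`-based) of the truncated Jacobi matrix
`J(α)_L^M` (of any size `L − M + 1`). -/
def JE (α : ℝ) (M : ℕ) (i j : ℕ) : ℝ :=
  if i + 1 = j then b α (M + i + 1) else if j + 1 = i then b α (M + j + 1) else 0

/-- The truncated Jacobi matrix `J(α)_{M+l}^M`, of size `(l+1) × (l+1)`.
In particular `Jt α 0 l` is the Jacobi matrix `J(α)_l`. -/
def Jt (α : ℝ) (M l : ℕ) : Matrix (Fin (l + 1)) (Fin (l + 1)) ℝ :=
  fun i j => JE α M i.1 j.1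

/-- The spherical harmonics `Y_l^k(θ, φ)`. -/
def Y (l : ℕ) (k : ℤ) (θ φ : ℝ) : ℂ :=
  ((Real.sin θ ^ k.natAbs : ℝ) : ℂ) * ((p (k.natAbs : ℝ) (l - k.natAbs) (Real.cos θ) : ℝ) : ℂ) *
    Complex.exp (Complex.I * (k : ℂ) * (φ : ℂ))

/-- Parameter region `[0, π] × [0, 2π]` of spherical coordinates. -/
def region : Set (ℝ × ℝ) := Set.Icc (0 : ℝ) Real.pi ×ˢ Set.Icc (0 : ℝ) (2 * Real.pi)

/-- The inner product of `L²(S²)`. -/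
def inner2 (f g : ℝ → ℝ → ℂ) : ℂ :=
  (1 / (4 * Real.pi)) *
    ∫ q in region, f q.1 q.2 * (starRingEnd ℂ) (g q.1 q.2) * ((Real.sin q.1 : ℝ) : ℂ)

/-- The norm of `L²(S²)`. -/
def norm2 (f : ℝ → ℝ → ℂ) : ℝ := Real.sqrt (inner2 f f).re

/-- Membership in `L²(S²)`. -/
def MemL2 (f : ℝ → ℝ → ℂ) : Prop :=
  Measurable (fun q : ℝ × ℝ => f q.1 q.2) ∧
    IntegrableOn (fun q : ℝ × ℝ => ‖f q.1 q.2‖ ^ 2 * Real.sin q.1) region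

/-- The multiplication operator `M`. -/
def Mop (f : ℝ → ℝ → ℂ) : ℝ → ℝ → ℂ := fun θ φ => ((Real.cos θ : ℝ) : ℂ) * f θ φ

/-- The power `M^j` of the multiplication operator. -/
def Mpow (j : ℕ) (f : ℝ → ℝ → ℂ) : ℝ → ℝ → ℂ := fun θ φ => ((Real.cos θ : ℝ) : ℂ) ^ j * f θ φ

/-- The mean value `ε(f)`. -/
def eps (f : ℝ → ℝ → ℂ) : ℝ :=
  (1 / (4 * Real.pi)) * ∫ q in region, Real.cos q.1 * ‖f q.1 q.2‖ ^ 2 * Real.sin q.1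

/-- The projection `P_n^m` onto `Π_n^m`. -/
def Pr (n m : ℕ) (f : ℝ → ℝ → ℂ) : ℝ → ℝ → ℂ :=
  fun θ φ => ∑ l ∈ Finset.Icc m n, ∑ k ∈ Finset.Icc (-(l : ℤ)) (l : ℤ),
    inner2 f (Y l k) * Y l k θ φ

/-- The space–frequency operator `P_n^m M P_n^m`. -/
def SFop (n m : ℕ) (f : ℝ → ℝ → ℂ) : ℝ → ℝ → ℂ := Pr n m (Mop (Pr n m f))

/-- The space `Π_n^m`, spanned by the spherical harmonics `Y_l^k`, `m ≤ l ≤ n`, `|k| ≤ l`. -/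
def Pi_nm (n m : ℕ) : Submodule ℂ (ℝ → ℝ → ℂ) :=
  Submodule.span ℂ {g | ∃ l : ℕ, ∃ k : ℤ, m ≤ l ∧ l ≤ n ∧ k.natAbs ≤ l ∧ g = Y l k}

/-- `N_k = n − max(|k|, m) + 1`. -/
def Nk (n m k : ℕ) : ℕ := n - max k m + 1

/-- The normalizing constant `κ_{k,i}`, given the corresponding root value `xr`. -/
def kap (n m k : ℕ) (xr : ℝ) : ℝ :=
  (Real.sqrt (∑ l ∈ Finset.Icc (max k m) n, (pA (k : ℝ) (m - k) (l - max k m) xr) ^ 2))⁻¹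

/-- The eigenfunction `ψ_{k,i}`, given the corresponding root value `xr`. -/
def psiFun (n m : ℕ) (k : ℤ) (xr : ℝ) : ℝ → ℝ → ℂ :=
  fun θ φ => ((kap n m k.natAbs xr : ℝ) : ℂ) *
    ∑ l ∈ Finset.Icc (max k.natAbs m) n,
      ((pA (k.natAbs : ℝ) (m - k.natAbs) (l - max k.natAbs m) xr : ℝ) : ℂ) * Y l k θ φ

lemma b_zero_pos (k : ℕ) : 0 < b k 0 := by
  simp only [b]
  have h1 : 0 < Real.Gamma ((k:ℝ) + 1) := Real.Gamma_pos_of_pos (by positivity)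
  have h2 : 0 < Real.Gamma ((k:ℝ) + 3/2) := Real.Gamma_pos_of_pos (by positivity)
  have := Real.pi_pos
  positivity

lemma b_arg_pos (k l : ℕ) : 0 < ((((l : ℝ) + 1) * (((l : ℝ) + 1) + 2 * (k:ℝ))) /
      ((2 * ((l : ℝ) + 1) + 2 * k + 1) * (2 * ((l : ℝ) + 1) + 2 * k - 1))) := by
  have : (0:ℝ) < 2 * ((l : ℝ) + 1) + 2 * k - 1 := by
    have : (0:ℝ) ≤ l := by positivity
    have : (0:ℝ) ≤ k := by positivity
    linarith
  positivity

lemma b_pos (k l : ℕ) : 0 < b k l := by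
  cases l with
  | zero => exact b_zero_pos k
  | succ l =>
    simp only [b]
    exact Real.sqrt_pos.mpr (b_arg_pos k l)

lemma b_sq (k l : ℕ) : b k (l+1) ^ 2 = ((((l : ℝ) + 1) * (((l : ℝ) + 1) + 2 * (k:ℝ))) /
      ((2 * ((l : ℝ) + 1) + 2 * k + 1) * (2 * ((l : ℝ) + 1) + 2 * k - 1))) := by
  simp only [b]
  exact Real.sq_sqrt (b_arg_pos k l).le

open Polynomial in
/-- polynomial version -/
def PP (α : ℝ) : ℕ → ℝ[X]
  | 0 => C (1 / b α 0)
  | 1 => C (1 / b α 1) * (X * C (1 / b α 0))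
  | l + 2 => C (1 / b α (l + 2)) * (X * PP α (l+1) - C (b α (l + 1)) * PP α l)

lemma PP_eval (α : ℝ) (x : ℝ) (l : ℕ) : (PP α l).eval x = p α l x := by
  induction l using Nat.twoStepInduction with
  | zero => simp [PP, p, pA]
  | one => simp [PP, p, pA]; ring
  | more l h1 h2 =>
    simp only [p] at h1 h2
    simp [PP, p, pA, h1, h2]; ring

open Polynomial in
lemma PP_rec0 (k : ℕ) : X * PP k 0 = C (b k 1) * PP k 1 := by
  have := (b_pos k 1).ne'
  simp only [PP]
  rw [← mul_assoc, ← C_mul, mul_one_div_cancel this]; simp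

open Polynomial in
lemma PP_rec (k l : ℕ) : X * PP k (l+1) = C (b k (l+2)) * PP k (l+2) + C (b k (l+1)) * PP k l := by
  have := (b_pos k (l+2)).ne'
  rw [PP.eq_3]
  rw [← mul_assoc (C (b k (l+2))), ← C_mul, mul_one_div_cancel this]; simp

lemma b_key (k l : ℕ) : 1 + (2 * l + 2 * k + 1) * b k (l+1) ^ 2 = (2 * l + 2 * k + 5) * b k (l+2) ^ 2 := by
  rw [b_sq, show l + 2 = (l+1)+1 from rfl, b_sq]
  have h : (0:ℝ) < 2 * l + 2 * k + 1 := by positivity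
  have h : (0:ℝ) < 2 * l + 2 * k + 3 := by positivity
  have h : (0:ℝ) < 2 * l + 2 * k + 5 := by positivity
  push_cast
  rw [show (2 * ((l : ℝ) + 1) + 2 * k - 1) = 2 * l + 2 * k + 1 by ring,
   show (2 * ((l : ℝ) + 1) + 2 * k + 1) = 2 * l + 2 * k + 3 by ring,
   show (2 * ((l : ℝ) + 1 + 1) + 2 * k - 1) = 2 * l + 2 * k + 3 by ring,
   show (2 * ((l : ℝ) + 1 + 1) + 2 * k + 1) = 2 * l + 2 * k + 5 by ring]
  field_simp
  ring

open Polynomial in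
lemma PP_struct0 (k : ℕ) : (1 - X^2) * derivative (PP k 1) =
    - X * PP k 1 + C ((2*k+3) * b k 1) * PP k 0 := by
  have hb := (b_pos k 1).ne'
  have hsq : (2*k+3) * b k 1 ^2 = 1 := by
    rw [b_sq]; have h : (0:ℝ) < 2 * k + 1 := by positivity
    have h : (0:ℝ) < 2 * k + 3 := by positivity
    push_cast
    rw [show (2 * ((0 : ℝ) + 1) + 2 * k - 1) = 2 * k + 1 by ring,
      show (2 * ((0 : ℝ) + 1) + 2 * k + 1) = 2 * k + 3 by ring]
    field_simp
    ring
  have h0 := congrArg derivative (PP_rec0 k)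
  have h0' := PP_rec0 k
  have h00 : derivative (PP k 0) = 0 := by simp [PP]
  simp only [derivative_mul, derivative_X, h00, derivative_C] at h0
  have e := congrArg (C : ℝ → ℝ[X]) hsq
  have two : (C (2:ℝ) : ℝ[X]) = 2 := rfl
  have three : (C (3:ℝ) : ℝ[X]) = 3 := rfl
  simp [two, three] at e h0 h0' ⊢
  apply mul_left_cancel₀ (C_ne_zero.mpr hb)
  linear_combination (-(1-X^2)) * h0 - X * h0' - PP k 0 * e

open Polynomial in
lemma PP_struct (k l : ℕ) : (1 - X^2) * derivative (PP k (l+1)) =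
    - C ((l:ℝ)+1) * X * PP k (l+1) + C ((2*l+2*k+3) * b k (l+1)) * PP k l := by
  have two : (C (2:ℝ) : ℝ[X]) = 2 := rfl
  have three : (C (3:ℝ) : ℝ[X]) = 3 := rfl
  have five : (C (5:ℝ) : ℝ[X]) = 5 := rfl
  induction l using Nat.twoStepInduction with
  | zero =>
    have := PP_struct0 k
    simp at this ⊢
    exact this
  | one =>
    have hb := (b_pos k 2).ne'
    have hsq := b_key k 0
    have h0 := congrArg derivative (PP_rec k 0)
    have h0' := PP_rec k 0
    have h00 : derivative (PP k 0) = 0 := by simp [PP]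
    have h1' := PP_rec0 k
    have ih2 := PP_struct0 k
    simp only [derivative_mul, derivative_add, derivative_X, h00, derivative_C] at h0
    have e := congrArg (C : ℝ → ℝ[X]) hsq
    simp [two, three, five] at e h0 h0' h1' ih2 ⊢
    apply mul_left_cancel₀ (C_ne_zero.mpr hb)
    linear_combination (-(1-X^2)) * h0 - 2 * X * h0' + (PP k 1) * e + X * ih2 + (2*k+1) * C (b k 1) * h1'
  | more l ih1 ih2 =>
    have hb := (b_pos k (l+3)).ne'
    have hsq := b_key k (l+1)
    have h0 := congrArg derivative (PP_rec k (l+1))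
    have h0' := PP_rec k (l+1)
    have h1' := PP_rec k l
    simp only [derivative_mul, derivative_add, derivative_X, derivative_C] at h0
    have e := congrArg (C : ℝ → ℝ[X]) hsq
    simp [two, three, five] at e h0 h0' h1' ih1 ih2 ⊢
    apply mul_left_cancel₀ (C_ne_zero.mpr hb)
    linear_combination (-(1-X^2)) * h0 - (l+3) * X * h0' + (PP k (l+2)) * e + X * ih2 - C (b k (l+2)) * ih1 + (2*l+2*k+3) * C (b k (l+2)) * h1'

open Polynomial in
/-- The functional. -/
def LL (k : ℕ) : ℝ[X] →ₗ[ℝ] ℝ where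
  toFun q := (1/2) * ∫ θ in (0:ℝ)..Real.pi, Real.sin θ ^ (2*k+1) * q.eval (Real.cos θ)
  map_add' q r := by
    rw [← mul_add, ← intervalIntegral.integral_add]
    · simp [mul_add]
    · exact Continuous.intervalIntegrable (by fun_prop) _ _
    · exact Continuous.intervalIntegrable (by fun_prop) _ _
  map_smul' c q := by
    simp only [eval_smul, smul_eq_mul, RingHom.id_apply]
    rw [mul_left_comm, ← intervalIntegral.integral_const_mul c]
    congr 1; apply intervalIntegral.integral_congr; intro θ _; simp only []; ring

open Polynomial in
lemma LL_parts (k : ℕ) (q : ℝ[X]) : LL k ((1 - X^2) * derivative q) = (2*k+2) * LL k (X * q) := by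
  have h : ∀ θ ∈ Set.uIcc 0 Real.pi, HasDerivAt (fun θ => Real.sin θ ^ (2*k+2) * q.eval (Real.cos θ))
     (Real.sin θ ^ (2*k+1) * ((2*k+2) * (X * q).eval (Real.cos θ)) - Real.sin θ ^ (2*k+1) * ((1 - X^2) * derivative q).eval (Real.cos θ)) θ := by
    intro θ _
    have h1 := (Real.hasDerivAt_sin θ).pow (2*k+2)
    have h2 := (q.hasDerivAt (Real.cos θ)).comp θ (Real.hasDerivAt_cos θ)
    have h3 := h1.mul h2
    refine h3.congr_deriv ?_
    have hs : 1 - Real.cos θ ^ 2 = Real.sin θ ^ 2 := by rw [Real.sin_sq]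
    simp [hs]
    ring
  have := intervalIntegral.integral_eq_sub_of_hasDerivAt h
    (Continuous.intervalIntegrable (by fun_prop) _ _)
  rw [intervalIntegral.integral_sub (Continuous.intervalIntegrable (by fun_prop) _ _)
     (Continuous.intervalIntegrable (by fun_prop) _ _)] at this
  simp only [mul_left_comm _ (2*(k:ℝ)+2)] at this
  rw [intervalIntegral.integral_const_mul] at this
  simp [-eval_mul] at this
  simp only [LL, LinearMap.coe_mk, AddHom.coe_mk]
  linarith

open Polynomial in
lemma LL_succ (k : ℕ) (q : ℝ[X]) : LL (k+1) q = LL k ((1 - X^2) * q) := by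
  simp only [LL, LinearMap.coe_mk, AddHom.coe_mk]
  congr 2; ext θ
  have hs : 1 - Real.cos θ ^ 2 = Real.sin θ ^ 2 := by rw [Real.sin_sq]
  simp [hs]; ring

lemma b_zero_sq (k : ℕ) : b k 0 ^ 2 = (Real.sqrt Real.pi * Real.Gamma ((k:ℝ) + 1) / (2 * Real.Gamma ((k:ℝ) + 3 / 2))) := by
  simp only [b]
  have h1 : 0 < Real.Gamma ((k:ℝ) + 1) := Real.Gamma_pos_of_pos (by positivity)
  have h2 : 0 < Real.Gamma ((k:ℝ) + 3/2) := Real.Gamma_pos_of_pos (by positivity)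
  exact Real.sq_sqrt (by positivity)

open Polynomial in
lemma LL_one (k : ℕ) : LL k 1 = b k 0 ^ 2 := by
  induction k with
  | zero =>
    rw [b_zero_sq]
    have : Real.Gamma (3/2) = Real.sqrt Real.pi / 2 := by
      rw [show (3/2:ℝ) = 1/2 + 1 by norm_num, Real.Gamma_add_one (by norm_num), Real.Gamma_one_half_eq]; ring
    have hp : Real.sqrt Real.pi ≠ 0 := (Real.sqrt_pos.mpr Real.pi_pos).ne'
    simp [LL, this]
    rw [mul_div_cancel₀ _ two_ne_zero, div_self hp]; norm_num
  | succ k ih =>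
    rw [LL_succ]
    have h := LL_parts k X
    rw [show X * X = 1 - (1 - X^2) * (1:ℝ[X]) by ring, map_sub, derivative_X, ih] at h
    rw [b_zero_sq] at h
    rw [b_zero_sq]
    have h2 : 0 < Real.Gamma ((k:ℝ) + 3/2) := Real.Gamma_pos_of_pos (by positivity)
    push_cast
    rw [show (k:ℝ) + 1 + 3/2 = (k + 3/2) + 1 by ring, Real.Gamma_add_one (by positivity : (k:ℝ) + 3/2 ≠ 0),
      Real.Gamma_add_one (by positivity : (k:ℝ) + 1 ≠ 0)]
    generalize LL k ((1 - X^2) * 1) = t at *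
    have h3 : (2*k+3) * t = (2*k+2) * (Real.sqrt Real.pi * Real.Gamma ((k:ℝ) + 1) / (2 * Real.Gamma ((k:ℝ) + 3 / 2))) := by linarith
    have h4 : (0:ℝ) < 2*k+3 := by positivity
    apply mul_left_cancel₀ h4.ne'
    rw [h3]
    field_simp

open Polynomial in
lemma LL_PP (k l : ℕ) : LL k (PP k (l+1)) = 0 := by
  have h0 : LL k (PP k 1) = 0 := by
    have h := LL_parts k (PP k 0)
    rw [PP_rec0] at h
    have h00 : derivative (PP k 0) = 0 := by simp [PP]
    rw [h00, ← smul_eq_C_mul, map_smul] at h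
    have : (0:ℝ) < 2*k+2 := by positivity
    have hb := (b_pos k 1).ne'
    simpa [this.ne', hb] using h
  have hs : ∀ l : ℕ, (l+2*k+3) * (b k (l+2) * LL k (PP k (l+2))) = l * b k (l+1) * LL k (PP k l) := by
    intro l
    have h := LL_parts k (PP k (l+1))
    rw [PP_struct, mul_assoc, PP_rec, ← C_neg] at h
    generalize hc : -((l:ℝ)+1) = c at h
    simp only [← smul_eq_C_mul, map_smul, map_add, smul_eq_mul] at h
    subst hc
    linarith
  induction l using Nat.twoStepInduction with
  | zero => exact h0
  | one =>
    have h := hs 0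
    have hb := (b_pos k 2).ne'
    have : (0:ℝ) < 2*k+3 := by positivity
    simpa [this.ne', hb] using h
  | more l h1 h2 =>
    have h := hs (l+1)
    rw [h1] at h
    have hb := (b_pos k (l+3)).ne'
    have : (0:ℝ) < (l+1:ℕ)+2*k+3 := by positivity
    rw [mul_zero] at h
    have := (mul_eq_zero.mp h).resolve_left this.ne'
    exact (mul_eq_zero.mp this).resolve_left hb

open Polynomial in
lemma orth (k i j : ℕ) : LL k (PP k i * PP k j) = if i = j then 1 else 0 := by
  have e0 : ∀ j, LL k (PP k 0 * PP k j) = if 0 = j then 1 else 0 := by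
    intro j
    rw [PP, ← smul_eq_C_mul, map_smul]
    cases j with
    | zero =>
      rw [PP, ← mul_one (C _), ← smul_eq_C_mul, map_smul, LL_one]
      have hb := (b_pos k 0).ne'
      simp; field_simp
    | succ j => rw [LL_PP]; simp
  have m0 : ∀ q, LL k ((X * PP k 0) * q) = b k 1 * LL k (PP k 1 * q) := by
    intro q
    rw [PP_rec0, mul_assoc, ← smul_eq_C_mul, map_smul, smul_eq_mul]
  have ms : ∀ l q, LL k ((X * PP k (l+1)) * q) = b k (l+2) * LL k (PP k (l+2) * q) + b k (l+1) * LL k (PP k l * q) := by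
    intro l q
    rw [PP_rec, add_mul, mul_assoc, mul_assoc, ← smul_eq_C_mul, ← smul_eq_C_mul, map_add, map_smul, map_smul, smul_eq_mul, smul_eq_mul]
  have sw : ∀ q r : ℝ[X], LL k ((X * q) * r) = LL k ((X * r) * q) := by intro q r; congr 1; ring
  induction i using Nat.twoStepInduction generalizing j with
  | zero => exact e0 j
  | one =>
    have hb := (b_pos k 1).ne'
    have h := m0 (PP k j)
    rw [sw] at h
    apply mul_left_cancel₀ hb
    rw [← h]
    cases j with
    | zero => rw [m0, mul_comm, mul_comm (PP k 1), e0]; simp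
    | succ j =>
      rw [ms, mul_comm (PP k _), e0, mul_comm (PP k _), e0]
      cases j <;> simp
  | more l h1 h2 =>
    have hb := (b_pos k (l+2)).ne'
    have h := ms l (PP k j)
    rw [sw, h1] at h
    apply mul_left_cancel₀ hb
    rw [eq_sub_of_add_eq h.symm]
    cases j with
    | zero => rw [m0, mul_comm (PP k 1), h2]; rcases l with _ | l <;> simp
    | succ j =>
      rw [ms, mul_comm (PP k _), h2, mul_comm (PP k _), h2]
      by_cases c1 : l + 2 = j + 1
      · have : l + 1 = j := by omega
        subst this; simp; intro h; omega
      · have c2 : l + 1 ≠ j := by omega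
        by_cases c3 : l = j + 1
        · subst c3; simp; intro h; omega
        · have : l + 1 ≠ j + 2 := by omega
          simp [c1, c2, c3]

open Polynomial in
lemma orthX (k i j : ℕ) : LL k (X * (PP k i * PP k j)) = JE k 0 i j := by
  rw [← mul_assoc]
  cases i with
  | zero =>
    rw [PP_rec0, mul_assoc, ← smul_eq_C_mul, map_smul, smul_eq_mul, orth]
    simp [JE]
  | succ l =>
    rw [PP_rec, add_mul, mul_assoc, mul_assoc, ← smul_eq_C_mul, ← smul_eq_C_mul, map_add, map_smul, map_smul, smul_eq_mul, smul_eq_mul, orth, orth]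
    simp only [JE]
    by_cases c1 : l + 2 = j
    · have : l ≠ j := by omega
      subst c1; simp
    · by_cases c2 : l = j
      · subst c2; simp; intro h; omega
      · have : j ≠ l := fun h => c2 h.symm
        simp [c1, c2, this]

lemma exp_int (k k' : ℤ) : ∫ φ in Set.Icc (0:ℝ) (2 * Real.pi),
    Complex.exp (Complex.I * ((k:ℂ) - k') * (φ:ℂ)) = if k = k' then ((2 * Real.pi : ℝ) : ℂ) else 0 := by
  have hp := Real.pi_pos
  rw [integral_Icc_eq_integral_Ioc, ← intervalIntegral.integral_of_le (by positivity)]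
  split_ifs with h
  · subst h; simp
  · have hne : Complex.I * ((k:ℂ) - k') ≠ 0 := by
      apply mul_ne_zero Complex.I_ne_zero
      rw [sub_ne_zero]; exact_mod_cast h
    rw [integral_exp_mul_complex hne]
    have : Complex.exp (Complex.I * ((k:ℂ) - k') * ((2 * Real.pi : ℝ):ℂ)) = 1 := by
      rw [Complex.exp_eq_one_iff]
      exact ⟨k - k', by push_cast; ring⟩
    rw [this]; simp

lemma Y_cont (l : ℕ) (k : ℤ) : Continuous (fun q : ℝ × ℝ => Y l k q.1 q.2) := by
  unfold Y
  simp only [← PP_eval]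
  fun_prop

open Polynomial in
lemma innerY (q : ℝ[X]) (l l' : ℕ) (k k' : ℤ) :
    inner2 (fun θ φ => ((q.eval (Real.cos θ) : ℝ) : ℂ) * Y l k θ φ) (Y l' k') =
      if k = k' then ((LL k.natAbs (q * (PP k.natAbs (l - k.natAbs) * PP k.natAbs (l' - k.natAbs))) : ℝ) : ℂ) else 0 := by
  have hp := Real.pi_pos
  have e : ∀ r : ℝ × ℝ, ((q.eval (Real.cos r.1) : ℝ) : ℂ) * Y l k r.1 r.2 * (starRingEnd ℂ) (Y l' k' r.1 r.2) * ((Real.sin r.1 : ℝ) : ℂ)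
      = (fun θ : ℝ => ((Real.sin θ ^ (k.natAbs + k'.natAbs + 1) * (q.eval (Real.cos θ) * ((PP k.natAbs (l - k.natAbs)).eval (Real.cos θ) * (PP k'.natAbs (l' - k'.natAbs)).eval (Real.cos θ))) : ℝ) : ℂ)) r.1
       * (fun φ : ℝ => Complex.exp (Complex.I * ((k:ℂ) - k') * (φ:ℂ))) r.2 := by
    intro r
    have : Complex.exp (Complex.I * ((k:ℂ) - k') * (r.2:ℂ)) = Complex.exp (Complex.I * k * r.2) * (starRingEnd ℂ) (Complex.exp (Complex.I * k' * r.2)) := by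
      rw [← Complex.exp_conj, ← Complex.exp_add]
      congr 1
      simp; ring
    simp only [this, Y, PP_eval, map_mul, Complex.conj_ofReal]
    simp only [Complex.ofReal_mul, Complex.ofReal_pow]
    ring
  unfold inner2
  rw [integral_congr_ae (Filter.Eventually.of_forall e)]
  rw [region, Measure.volume_eq_prod, setIntegral_prod_mul
    (fun θ : ℝ => ((Real.sin θ ^ (k.natAbs + k'.natAbs + 1) * (q.eval (Real.cos θ) * ((PP k.natAbs (l - k.natAbs)).eval (Real.cos θ) * (PP k'.natAbs (l' - k'.natAbs)).eval (Real.cos θ))) : ℝ) : ℂ))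
    (fun φ : ℝ => Complex.exp (Complex.I * ((k:ℂ) - k') * (φ:ℂ))), exp_int]
  split_ifs with h
  · subst h
    rw [integral_complex_ofReal, integral_Icc_eq_integral_Ioc, ← intervalIntegral.integral_of_le hp.le]
    simp only [LL, LinearMap.coe_mk, AddHom.coe_mk, eval_mul, ← two_mul]
    push_cast
    have : (Real.pi:ℂ) ≠ 0 := by exact_mod_cast hp.ne'
    field_simp
    norm_num [mul_comm]
  · simp

lemma innerYY (l l' : ℕ) (k k' : ℤ) (h : k.natAbs ≤ l) (h' : k'.natAbs ≤ l') :
    inner2 (Y l k) (Y l' k') = if k = k' then (if l = l' then 1 else 0) else 0 := by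
  have := innerY 1 l l' k k'
  simp only [Polynomial.eval_one, Complex.ofReal_one, one_mul] at this
  rw [show (fun θ φ => Y l k θ φ) = Y l k from rfl] at this
  rw [this]
  split_ifs with h1 h2 h2
  · rw [orth, if_pos (by rw [h2])]; simp
  · rw [orth, if_neg (by subst h1; omega)]; simp
  · rfl

lemma innerMY (l l' : ℕ) (k k' : ℤ) :
    inner2 (Mop (Y l k)) (Y l' k') = if k = k' then ((JE k.natAbs 0 (l - k.natAbs) (l' - k.natAbs) : ℝ) : ℂ) else 0 := by
  have := innerY Polynomial.X l l' k k'
  simp only [Polynomial.eval_X] at this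
  rw [orthX] at this
  exact this

lemma inner2_sum {ι : Type*} [Fintype ι] (v : ι → ℂ) (F : ι → ℝ → ℝ → ℂ) (g : ℝ → ℝ → ℂ)
    (hF : ∀ i, Continuous (fun q : ℝ × ℝ => F i q.1 q.2)) (hg : Continuous (fun q : ℝ × ℝ => g q.1 q.2)) :
    inner2 (fun θ φ => ∑ i, v i * F i θ φ) g = ∑ i, v i * inner2 (F i) g := by
  unfold inner2
  simp_rw [Finset.sum_mul]
  rw [integral_finsetSum]
  · rw [Finset.mul_sum]
    apply Finset.sum_congr rfl
    intro i _
    rw [mul_left_comm, ← integral_const_mul (v i)]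
    congr 1; apply integral_congr_ae; refine Filter.Eventually.of_forall (fun q => ?_); simp only []; ring
  · intro i _
    have hr : IsCompact region := isCompact_Icc.prod isCompact_Icc
    have h1 := hF i
    have : Continuous (fun q : ℝ × ℝ => v i * F i q.1 q.2 * (starRingEnd ℂ) (g q.1 q.2) * ((Real.sin q.1 : ℝ) : ℂ)) := by
      have := Complex.continuous_conj.comp hg
      simp only [Function.comp_def] at this
      fun_prop
    exact this.continuousOn.integrableOn_compact hr

lemma sum_swap (n m : ℕ) (f : ℕ → ℤ → ℂ) :
    ∑ l ∈ Finset.Icc m n, ∑ k ∈ Finset.Icc (-(l : ℤ)) (l : ℤ), f l k =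
    ∑ k ∈ Finset.Icc (-(n : ℤ)) (n : ℤ), ∑ l ∈ Finset.Icc (max k.natAbs m) n, f l k := by
  apply Finset.sum_comm'
  intro l k
  simp only [Finset.mem_Icc]
  omega

lemma sum_fin (a n : ℕ) (h : a ≤ n) (f : ℕ → ℂ) :
    ∑ l ∈ Finset.Icc a n, f l = ∑ i : Fin (n - a + 1), f (a + i) := by
  rw [Fin.sum_univ_eq_sum_range (fun i => f (a + i)), ← Finset.Ico_add_one_right_eq_Icc, Finset.sum_Ico_eq_sum_range]
  congr 2; omega

/-- combos -/
def comb (n m : ℕ) (k : ℤ) (v : Fin (n - max k.natAbs m + 1) → ℂ) : ℝ → ℝ → ℂ :=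
  fun θ φ => ∑ i, v i * Y (max k.natAbs m + i) k θ φ

lemma Pr_eq (n m : ℕ) (hmn : m ≤ n) (k : ℤ) (hk : k.natAbs ≤ n) (f : ℝ → ℝ → ℂ) (c : ℕ → ℂ)
    (hf : ∀ l' k', k'.natAbs ≤ l' → inner2 f (Y l' k') = if k = k' then c l' else 0) :
    Pr n m f = comb n m k (fun i => c (max k.natAbs m + i)) := by
  funext θ φ
  unfold Pr comb
  rw [sum_swap n m (fun l k => inner2 f (Y l k) * Y l k θ φ), Finset.sum_eq_single k]
  · rw [sum_fin _ _ (by omega)]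
    apply Finset.sum_congr rfl
    intro i _
    rw [hf _ _ (by omega), if_pos rfl]
  · intro k' hk' hne
    apply Finset.sum_eq_zero
    intro l hl
    rw [Finset.mem_Icc] at hl
    rw [hf _ _ (by omega), if_neg (Ne.symm hne), zero_mul]
  · intro h
    exact absurd (Finset.mem_Icc.mpr (by omega)) h

lemma inner_comb (n m : ℕ) (k : ℤ) (v) (l' : ℕ) (k' : ℤ) (h' : k'.natAbs ≤ l') :
    inner2 (comb n m k v) (Y l' k') = if k = k' then (∑ i, v i * (if max k.natAbs m + i = l' then 1 else 0)) else 0 := by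
  unfold comb
  rw [inner2_sum _ _ _ (fun i => Y_cont _ _) (Y_cont _ _)]
  split_ifs with h
  · apply Finset.sum_congr rfl
    intro i _
    rw [innerYY _ _ _ _ (by omega) h', if_pos h]
  · apply Finset.sum_eq_zero
    intro i _
    rw [innerYY _ _ _ _ (by omega) h', if_neg h, mul_zero]

lemma inner_Mcomb (n m : ℕ) (k : ℤ) (v) (l' : ℕ) (k' : ℤ) :
    inner2 (Mop (comb n m k v)) (Y l' k') = if k = k' then (∑ i, v i * ((JE k.natAbs 0 (max k.natAbs m + (i:ℕ) - k.natAbs) (l' - k.natAbs) : ℝ) : ℂ)) else 0 := by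
  have : Mop (comb n m k v) = fun θ φ => ∑ i, v i * Mop (Y (max k.natAbs m + i) k) θ φ := by
    funext θ φ
    simp only [Mop, comb, Finset.mul_sum]
    apply Finset.sum_congr rfl
    intro i _; ring
  rw [this, inner2_sum _ _ _ _ (Y_cont _ _)]
  · simp only [innerMY]
    split_ifs with h
    · rfl
    · simp
  · intro i
    have := Y_cont (max k.natAbs m + i) k
    unfold Mop
    fun_prop

lemma Pr_comb (n m : ℕ) (hmn : m ≤ n) (k : ℤ) (hk : k.natAbs ≤ n) (v) :
    Pr n m (comb n m k v) = comb n m k v := by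
  rw [Pr_eq n m hmn k hk _ _ (fun l' k' h' => inner_comb n m k v l' k' h')]
  congr 1
  funext i
  rw [Finset.sum_eq_single i]
  · simp
  · intro j _ hj
    have : (j:ℕ) ≠ i := fun h => hj (Fin.ext h)
    simp [this]
  · simp

/-- complex Jacobi matrix -/
def JC (n m : ℕ) (k : ℤ) : Matrix (Fin (n - max k.natAbs m + 1)) (Fin (n - max k.natAbs m + 1)) ℂ :=
  (Jt k.natAbs (m - k.natAbs) (n - max k.natAbs m)).map Complex.ofReal

lemma JE_shift (α : ℝ) (M i j : ℕ) : JE α 0 (M + i) (M + j) = JE α M i j := by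
  simp [JE, add_assoc]

lemma SF_comb (n m : ℕ) (hmn : m ≤ n) (k : ℤ) (hk : k.natAbs ≤ n) (v) :
    SFop n m (comb n m k v) = comb n m k (Matrix.vecMul v (JC n m k)) := by
  unfold SFop
  rw [Pr_comb n m hmn k hk, Pr_eq n m hmn k hk _ _ (fun l' k' _ => inner_Mcomb n m k v l' k')]
  congr 1
  funext i
  simp only [Matrix.vecMul, dotProduct, JC, Matrix.map_apply, Jt]
  apply Finset.sum_congr rfl
  intro j _
  have e : ∀ j : ℕ, max k.natAbs m + j - k.natAbs = (m - k.natAbs) + j := by omega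
  rw [e, e, JE_shift]

lemma SF_iter (n m : ℕ) (hmn : m ≤ n) (k : ℤ) (hk : k.natAbs ≤ n) (v) (j : ℕ) :
    (SFop n m)^[j] (comb n m k v) = comb n m k (Matrix.vecMul v (JC n m k ^ j)) := by
  induction j with
  | zero => simp
  | succ j ih => rw [Function.iterate_succ_apply', ih, SF_comb n m hmn k hk, Matrix.vecMul_vecMul, pow_succ]

lemma diag_entry (n m : ℕ) (hmn : m ≤ n) (k : ℤ) (hk : k.natAbs ≤ n) (j : ℕ) (i : Fin (n - max k.natAbs m + 1)) :
    inner2 ((SFop n m)^[j] (Y (max k.natAbs m + i) k)) (Y (max k.natAbs m + i) k) = (JC n m k ^ j) i i := by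
  have : Y (max k.natAbs m + i) k = comb n m k (Pi.single i 1) := by
    funext θ φ
    unfold comb
    rw [Finset.sum_eq_single i]
    · simp
    · intro b _ hb; simp [Pi.single_apply, hb]
    · simp
  conv_lhs => rw [congrArg ((SFop n m)^[j]) this]
  rw [SF_iter n m hmn k hk, inner_comb _ _ _ _ _ _ (by omega), if_pos rfl, Finset.sum_eq_single i]
  · simp
  · intro b _ hb
    have : (b:ℕ) ≠ i := fun h => hb (Fin.ext h)
    simp [this]
  · simp

lemma J_eig (k M L : ℕ) (x : ℝ) (hx : pA k M (L+1) x = 0) :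
    (Jt k M L).mulVec (fun i => pA k M i x) = x • (fun i : Fin (L+1) => pA k M i x) := by
  have r0 : b k (M+1) * pA k M 1 x = x * pA k M 0 x := by
    have := (b_pos k (M+1)).ne'
    simp only [pA]; field_simp
  have rs : ∀ l, b k (M+l+2) * pA k M (l+2) x = x * pA k M (l+1) x - b k (M+l+1) * pA k M l x := by
    intro l
    have := (b_pos k (M+l+2)).ne'
    rw [pA.eq_3]; field_simp
  funext i
  simp only [Matrix.mulVec, dotProduct, Jt, Pi.smul_apply, smul_eq_mul]
  have ext : ∑ j : Fin (L+1), JE k M i j * pA k M j x = ∑ j ∈ Finset.range (L+2), JE k M i j * pA k M j x := by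
    rw [Finset.sum_range_succ, hx, mul_zero, add_zero, Fin.sum_univ_eq_sum_range (fun j => JE k M i j * pA k M j x)]
  rw [ext]
  obtain ⟨i, hi⟩ := i
  simp only
  cases i with
  | zero =>
    rw [Finset.sum_eq_single 1]
    · simpa [JE] using r0
    · intro j _ hj
      have : ¬ (1 = j) := fun h => hj h.symm
      simp [JE, this]
    · intro h; exact absurd (Finset.mem_range.mpr (by omega)) h
  | succ l =>
    have : ∀ j ∈ Finset.range (L+2), JE k M (l+1) j * pA k M j x =
       (if j = l+2 then b k (M+l+2) * pA k M (l+2) x else 0) + (if j = l then b k (M+l+1) * pA k M l x else 0) := by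
      intro j _
      simp only [JE]
      by_cases h1 : j = l + 2
      · subst h1; simp [add_assoc]
      · by_cases h2 : j = l
        · subst h2; simp; intro h; omega
        · rw [if_neg (by omega), if_neg (by omega), if_neg h1, if_neg h2]; simp
    rw [Finset.sum_congr rfl this, Finset.sum_add_distrib, Finset.sum_ite_eq', Finset.sum_ite_eq', if_pos (Finset.mem_range.mpr (by omega)), if_pos (Finset.mem_range.mpr (by omega)), rs]
    ring

lemma J_trace (k M L j : ℕ) (x : ℕ → ℝ) (hx : ∀ i < L+1, pA k M (L+1) (x i) = 0)
    (hinj : ∀ i < L+1, ∀ i' < L+1, x i = x i' → i = i') :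
    (Jt k M L ^ j).trace = ∑ i ∈ Finset.range (L+1), x i ^ j := by
  let V : Matrix (Fin (L+1)) (Fin (L+1)) ℝ := fun l i => pA k M l (x i)
  let D : Matrix (Fin (L+1)) (Fin (L+1)) ℝ := Matrix.diagonal (fun i => x i)
  have hJV : Jt k M L * V = V * D := by
    ext l i
    have := congrFun (J_eig k M L (x i) (hx i i.2)) l
    rw [Matrix.mul_diagonal]
    simp only [Pi.smul_apply, smul_eq_mul] at this
    rw [mul_comm (V l i)]
    exact this
  have hli : LinearIndependent ℝ (fun i => V.col i) := by
    apply Module.End.eigenvectors_linearIndependent' (Matrix.toLin' (Jt k M L)) (fun i : Fin (L+1) => x i)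
    · intro i i' h
      exact Fin.ext (hinj i i.2 i' i'.2 h)
    · intro i
      refine ⟨Module.End.mem_eigenspace_iff.mpr ?_, ?_⟩
      · rw [Matrix.toLin'_apply]
        exact J_eig k M L (x i) (hx i i.2)
      · intro h
        have := congrFun h 0
        change pA k M 0 (x i) = 0 at this
        simp [pA] at this
        exact (b_pos k M).ne' this
  have hV : IsUnit V := Matrix.linearIndependent_cols_iff_isUnit.mp hli
  have hpow : Jt k M L ^ j * V = V * D ^ j := by
    have : SemiconjBy V D (Jt k M L) := hJV.symm
    exact (this.pow_right j).symm
  have hdet : IsUnit V.det := (Matrix.isUnit_iff_isUnit_det V).mp hV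
  have : Jt k M L ^ j = V * D ^ j * V⁻¹ := by
    rw [← hpow, Matrix.mul_assoc, Matrix.mul_nonsing_inv _ hdet, Matrix.mul_one]
  rw [this, Matrix.trace_mul_comm, ← Matrix.mul_assoc, Matrix.nonsing_inv_mul _ hdet, Matrix.one_mul,
    Matrix.diagonal_pow, Matrix.trace_diagonal, ← Fin.sum_univ_eq_sum_range (fun i => x i ^ j)]
  rfl

/-- the trace of `(P_n^m M P_n^m)^j` restricted to `Π_n^m` equals
`Σ_{k=−n}^n Σ_{i=1}^{N_k} x_{|k|,i}^j`, where `x k i` enumerates the roots of the relevant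
(associated) ultraspherical polynomials. -/
theorem stmt16 (n m j : ℕ) (hmn : m ≤ n) (hj : 1 ≤ j) (x : ℕ → ℕ → ℝ)
    (hroot : ∀ k : ℕ, k ≤ n → ∀ i < Nk n m k, pA (k : ℝ) (m - k) (Nk n m k) (x k i) = 0)
    (hinj : ∀ k : ℕ, k ≤ n → ∀ i < Nk n m k, ∀ i' < Nk n m k, x k i = x k i' → i = i') :
    ∑ l ∈ Finset.Icc m n, ∑ k ∈ Finset.Icc (-(l : ℤ)) (l : ℤ),
        inner2 ((SFop n m)^[j] (Y l k)) (Y l k) =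
      ((∑ k ∈ Finset.Icc (-(n : ℤ)) (n : ℤ), ∑ i ∈ Finset.range (Nk n m k.natAbs),
          x k.natAbs i ^ j : ℝ) : ℂ) := by
  rw [sum_swap n m (fun l k => inner2 ((SFop n m)^[j] (Y l k)) (Y l k))]
  rw [Complex.ofReal_sum]
  apply Finset.sum_congr rfl
  intro k hk
  rw [Finset.mem_Icc] at hk
  have hk' : k.natAbs ≤ n := by omega
  rw [sum_fin _ _ (by omega)]
  have h := J_trace k.natAbs (m - k.natAbs) (n - max k.natAbs m) j (x k.natAbs)
    (hroot k.natAbs hk') (hinj k.natAbs hk')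
  unfold Nk
  rw [← h, Matrix.trace, Complex.ofReal_sum]
  apply Finset.sum_congr rfl
  intro i _
  rw [diag_entry n m hmn k hk']
  have : JC n m k ^ j = (Jt k.natAbs (m - k.natAbs) (n - max k.natAbs m) ^ j).map Complex.ofRealHom := by
    rw [Matrix.map_pow]; rfl
  rw [this]
  rfl
end SFT
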